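/- Suppose a group G acts properly by isometries on a proper geodesic metric space (X,d) and H ≤ G is an infinite quasi-convex subgroup. Then there exists Δ ≥ 0 such that #𝒜(n,Δ) ≥ exp(ω(H)·n) for every natural number n. -/

import Mathlib

open Metric Set Filter Pointwise

/-- `γ` restricted to `[0, L]` is a `(lam, c)`-quasi-geodesic parametrized by arc length:
the length of the subpath from `s` to `t` is `t - s`. -/
def IsQuasiGeodesicOn {X : Type*} [MetricSpace X] (γ : ℝ → X) (L lam c : ℝ) : Prop :=
  (∀ s t : ℝ, 0 ≤ s → s ≤ t → t ≤ L → dist (γ s) (γ t) ≤ t - s) ∧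
  (∀ s t : ℝ, 0 ≤ s → s ≤ t → t ≤ L → t - s ≤ lam * dist (γ s) (γ t) + c)

/-- `γ` restricted to `[0, L]` is a geodesic (unit speed). -/
def IsGeodesicOn {X : Type*} [MetricSpace X] (γ : ℝ → X) (L : ℝ) : Prop :=
  ∀ s t : ℝ, s ∈ Set.Icc 0 L → t ∈ Set.Icc 0 L → dist (γ s) (γ t) = |s - t|

/-- A metric space is geodesic if any two points are joined by a geodesic. -/
def GeodesicSpace (X : Type*) [MetricSpace X] : Prop :=
  ∀ x y : X, ∃ γ : ℝ → X, γ 0 = x ∧ γ (dist x y) = y ∧ IsGeodesicOn γ (dist x y)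

/-- The path `γ` on `[0, L]` is `M`-Morse: every `(lam, c)`-quasi-geodesic with endpoints
on `γ` stays within distance `M lam c` of the corresponding subpath of `γ`. -/
def IsMorseOn {X : Type*} [MetricSpace X] (γ : ℝ → X) (L : ℝ) (M : ℝ → ℝ → ℝ) : Prop :=
  ∀ lam c : ℝ, 1 ≤ lam → 0 ≤ c →
    ∀ (β : ℝ → X) (Lβ : ℝ), 0 ≤ Lβ → IsQuasiGeodesicOn β Lβ lam c →
      ∀ s t : ℝ, 0 ≤ s → s ≤ t → t ≤ L → β 0 = γ s → β Lβ = γ t →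
        ∀ u ∈ Set.Icc (0:ℝ) Lβ, ∃ v ∈ Set.Icc s t, dist (β u) (γ v) ≤ M lam c

/-- `γ` on `[0, Lγ]` is an `(L; M; lam, c)`-local Morse quasi-geodesic: every subpath of
length at most `L` is an `(M; lam, c)`-Morse quasi-geodesic. -/
def LocalMorseQuasiGeodesicOn {X : Type*} [MetricSpace X] (γ : ℝ → X) (Lγ L : ℝ)
    (M : ℝ → ℝ → ℝ) (lam c : ℝ) : Prop :=
  ∀ s t : ℝ, 0 ≤ s → s ≤ t → t ≤ Lγ → t - s ≤ L →
    IsQuasiGeodesicOn (fun u => γ (s + u)) (t - s) lam c ∧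
    IsMorseOn (fun u => γ (s + u)) (t - s) M

/-- Morse local-to-global space. -/
def MorseLocalToGlobalSpace (X : Type*) [MetricSpace X] : Prop :=
  ∀ (M : ℝ → ℝ → ℝ) (lam c : ℝ), 1 ≤ lam → 0 ≤ c →
    ∃ (M' : ℝ → ℝ → ℝ) (L lam' c' : ℝ), 0 ≤ L ∧ 1 ≤ lam' ∧ 0 ≤ c' ∧
      ∀ (γ : ℝ → X) (Lγ : ℝ), 0 ≤ Lγ → LocalMorseQuasiGeodesicOn γ Lγ L M lam c →
        IsQuasiGeodesicOn γ Lγ lam' c' ∧ IsMorseOn γ Lγ M'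

/-- A Morse geodesic ray: an isometric embedding of `[0, ∞)` which is `M`-Morse. -/
def IsMorseGeodesicRay {X : Type*} [MetricSpace X] (γ : ℝ → X) (M : ℝ → ℝ → ℝ) : Prop :=
  (∀ s t : ℝ, 0 ≤ s → 0 ≤ t → dist (γ s) (γ t) = |s - t|) ∧
  (∀ lam c : ℝ, 1 ≤ lam → 0 ≤ c →
    ∀ (β : ℝ → X) (Lβ : ℝ), 0 ≤ Lβ → IsQuasiGeodesicOn β Lβ lam c →
      ∀ s t : ℝ, 0 ≤ s → s ≤ t → β 0 = γ s → β Lβ = γ t →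
        ∀ u ∈ Set.Icc (0:ℝ) Lβ, ∃ v ∈ Set.Icc s t, dist (β u) (γ v) ≤ M lam c)

/-- The action of `G` on `X` is by isometries. -/
def IsometricAction (G X : Type*) [Group G] [MetricSpace X] [MulAction G X] : Prop :=
  ∀ (g : G) (x y : X), dist (g • x) (g • y) = dist x y

/-- The action of `G` on `X` is (metrically) proper. -/
def ProperAction (G X : Type*) [Group G] [MetricSpace X] [MulAction G X] : Prop :=
  ∀ (x : X) (r : ℝ), 0 < r → {g : G | dist x (g • x) ≤ r}.Finite

/-- The action of `G` on `X` is cocompact. -/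
def CocompactAction (G X : Type*) [Group G] [MetricSpace X] [MulAction G X] : Prop :=
  ∃ K : Set X, IsCompact K ∧ ∀ x : X, ∃ g : G, g • x ∈ K

/-- `H` is a stable subgroup: there are a Morse gauge `M` and `D ≥ 0` such that every
geodesic `[o, h • o]` is `M`-Morse and contained in the `D`-neighborhood of `H • o`. -/
def IsStableSubgroup {X G : Type*} [MetricSpace X] [Group G] [MulAction G X]
    (o : X) (H : Subgroup G) : Prop :=
  ∃ (M : ℝ → ℝ → ℝ) (D : ℝ), 0 ≤ D ∧
    ∀ h ∈ H, ∀ γ : ℝ → X, γ 0 = o → γ (dist o (h • o)) = h • o →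
      IsGeodesicOn γ (dist o (h • o)) →
      IsMorseOn γ (dist o (h • o)) M ∧
      ∀ s ∈ Set.Icc 0 (dist o (h • o)), ∃ h' ∈ H, dist (γ s) (h' • o) ≤ D

/-- A Morse element: an infinite order element generating a stable cyclic subgroup. -/
def IsMorseElement {X G : Type*} [MetricSpace X] [Group G] [MulAction G X]
    (o : X) (g : G) : Prop :=
  ¬ IsOfFinOrder g ∧ IsStableSubgroup o (Subgroup.zpowers g)

/-- `H` is quasi-convex: geodesics with endpoints on `H • o` stay in a `σ`-neighborhood
of `H • o`. -/
def IsQuasiConvexSubgroup {X G : Type*} [MetricSpace X] [Group G] [MulAction G X]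
    (o : X) (H : Subgroup G) : Prop :=
  ∃ σ : ℝ, 0 ≤ σ ∧ ∀ h h' : G, h ∈ H → h' ∈ H →
    ∀ γ : ℝ → X, γ 0 = h • o → γ (dist (h • o) (h' • o)) = h' • o →
      IsGeodesicOn γ (dist (h • o) (h' • o)) →
      ∀ s ∈ Set.Icc 0 (dist (h • o) (h' • o)), ∃ h'' ∈ H, dist (γ s) (h'' • o) ≤ σ

/-- The growth rate `ω(A) = limsup (log #(B(n) ∩ A)) / n` of a subset `A ⊆ G`. -/
noncomputable def growthRate {X G : Type*} [MetricSpace X] [Group G] [MulAction G X]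
    (o : X) (A : Set G) : ℝ :=
  Filter.limsup (fun n : ℕ =>
    Real.log ((A ∩ {g : G | dist o (g • o) ≤ (n : ℝ)}).ncard) / (n : ℝ)) Filter.atTop

/-- Convergence of the Poincaré series `𝒫_A(s) = Σ_{g ∈ A} exp (-s · d_G(1, g))`. -/
def PoincareSummable {X G : Type*} [MetricSpace X] [Group G] [MulAction G X]
    (o : X) (A : Set G) (s : ℝ) : Prop :=
  Summable fun g : A => Real.exp (-s * dist o ((g : G) • o))

/-- A group is virtually cyclic if it has a cyclic subgroup of finite index. -/
def VirtuallyCyclic (G : Type*) [Group G] : Prop :=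
  ∃ H : Subgroup G, IsCyclic H ∧ H.FiniteIndex

/-- The annulus set `𝒜(n, Δ) = {h ∈ H : |d_G(1,h) - n| ≤ Δ}`. -/
def annulus {X G : Type*} [MetricSpace X] [Group G] [MulAction G X]
    (o : X) (H : Subgroup G) (n Δ : ℝ) : Set G :=
  {h : G | h ∈ H ∧ |dist o (h • o) - n| ≤ Δ}

/-- Evaluation of a formal alternating word `a₁b₁a₂b₂⋯aₙbₙ` in `G`. -/
def evalWord {G : Type*} [Group G] (w : List (G × G)) : G :=
  (w.map fun p => p.1 * p.2).prod

/-- The set `𝕎(A, B)` of (nonempty) formal alternating words with letters in `A` and `B`. -/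
def AltWords {G : Type*} [Group G] (A B : Set G) : Set (List (G × G)) :=
  {w | w ≠ [] ∧ ∀ p ∈ w, p.1 ∈ A ∧ p.2 ∈ B}

/-- The nearest-point projection `π_A(x)` of a point to a subset `A ⊆ X`. -/
def projSet {X : Type*} [MetricSpace X] (A : Set X) (x : X) : Set X :=
  {a ∈ A | dist x a = Metric.infDist x A}

/-- The projection `π_A(Y) = ⋃_{y ∈ Y} π_A(y)` of a subset `Y` to `A`. -/
def projSetOf {X : Type*} [MetricSpace X] (A Y : Set X) : Set X :=
  ⋃ y ∈ Y, projSet A y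

section AnnulusGrowth

variable {X G : Type*} [MetricSpace X] [Group G] [MulAction G X]

theorem ProperAction.finite_orbitBall (hproper : ProperAction G X) (o : X) (r : ℝ) :
    {g : G | dist o (g • o) ≤ r}.Finite :=
  (hproper o (max r 1) (by positivity)).subset fun _ hg =>
    Set.mem_ofPred.2 ((Set.mem_ofPred.1 hg).trans (le_max_left _ _))

theorem ProperAction.finite_annulus (hproper : ProperAction G X) (o : X) (H : Subgroup G)
    (n D : ℝ) : (annulus o H n D).Finite :=
  (hproper.finite_orbitBall o (n + D)).subset fun g hg => by
    have := (abs_le.1 hg.2).2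
    simp only [mem_ofPred_eq]
    linarith

/-- Quasi-convexity lets one split an element of `H` along a geodesic `[o, h • o]`. -/
theorem exists_mem_dist_near_of_quasiConvex {o : X} (hgeo : GeodesicSpace X)
    {H : Subgroup G} {σ : ℝ}
    (hqc : ∀ h h' : G, h ∈ H → h' ∈ H →
      ∀ γ : ℝ → X, γ 0 = h • o → γ (dist (h • o) (h' • o)) = h' • o →
        IsGeodesicOn γ (dist (h • o) (h' • o)) →
        ∀ s ∈ Set.Icc 0 (dist (h • o) (h' • o)), ∃ h'' ∈ H, dist (γ s) (h'' • o) ≤ σ)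
    {h : G} (hh : h ∈ H) {s : ℝ} (hs : s ∈ Set.Icc 0 (dist o (h • o))) :
    ∃ k ∈ H, |dist o (k • o) - s| ≤ σ ∧
      |dist (k • o) (h • o) - (dist o (h • o) - s)| ≤ σ := by
  obtain ⟨γ, h0, h1, hγ⟩ := hgeo o (h • o)
  have key := hqc 1 h H.one_mem hh γ
  simp only [one_smul] at key
  obtain ⟨k, hk, hd⟩ := key h0 h1 hγ s hs
  have e1 : dist o (γ s) = s := by
    rw [← h0, hγ 0 s ⟨le_rfl, dist_nonneg⟩ hs, zero_sub, abs_neg, abs_of_nonneg hs.1]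
  have e2 : dist (γ s) (h • o) = dist o (h • o) - s := by
    conv_lhs => rw [← h1]
    rw [hγ s _ hs ⟨dist_nonneg, le_rfl⟩, abs_sub_comm, abs_of_nonneg (sub_nonneg.2 hs.2)]
  refine ⟨k, hk, abs_le.2 ⟨?_, ?_⟩, abs_le.2 ⟨?_, ?_⟩⟩
  · linarith [dist_triangle o (k • o) (γ s), dist_comm (γ s) (k • o)]
  · linarith [dist_triangle o (γ s) (k • o)]
  · linarith [dist_triangle (γ s) (k • o) (h • o)]
  · linarith [dist_triangle (k • o) (γ s) (h • o), dist_comm (γ s) (k • o)]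

theorem annulus_add_subset_mul {o : X} (hiso : IsometricAction G X) (hgeo : GeodesicSpace X)
    {H : Subgroup G} {σ D : ℝ} (hD : 2 * σ ≤ D)
    (hqc : ∀ h h' : G, h ∈ H → h' ∈ H →
      ∀ γ : ℝ → X, γ 0 = h • o → γ (dist (h • o) (h' • o)) = h' • o →
        IsGeodesicOn γ (dist (h • o) (h' • o)) →
        ∀ s ∈ Set.Icc 0 (dist (h • o) (h' • o)), ∃ h'' ∈ H, dist (γ s) (h'' • o) ≤ σ)
    {n m : ℝ} (hn : 0 ≤ n) (hm : 0 ≤ m) :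
    annulus o H (n + m) D ⊆ annulus o H n D * annulus o H m D := by
  rintro h ⟨hh, hd⟩
  rw [abs_le] at hd
  have hlen : 0 ≤ dist o (h • o) := dist_nonneg
  set ℓ := dist o (h • o) with hℓ
  by_cases h1 : n - m + ℓ < 0
  · refine Set.mem_mul.2 ⟨1, ⟨H.one_mem, ?_⟩, h, ⟨hh, ?_⟩, one_mul h⟩
    · simp only [one_smul, dist_self]
      exact abs_le.2 ⟨by linarith, by linarith⟩
    · rw [← hℓ]
      exact abs_le.2 ⟨by linarith, by linarith⟩
  by_cases h2 : m - n + ℓ < 0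
  · refine Set.mem_mul.2 ⟨h, ⟨hh, ?_⟩, 1, ⟨H.one_mem, ?_⟩, mul_one h⟩
    · rw [← hℓ]
      exact abs_le.2 ⟨by linarith, by linarith⟩
    · simp only [one_smul, dist_self]
      exact abs_le.2 ⟨by linarith, by linarith⟩
  obtain ⟨k, hk, hk1, hk2⟩ := exists_mem_dist_near_of_quasiConvex hgeo hqc hh
    (s := (n - m + ℓ) / 2) ⟨by linarith, by linarith⟩
  rw [← hℓ] at hk2
  rw [abs_le] at hk1 hk2
  refine Set.mem_mul.2 ⟨k, ⟨hk, ?_⟩, k⁻¹ * h, ⟨H.mul_mem (H.inv_mem hk) hh, ?_⟩,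
    mul_inv_cancel_left k h⟩
  · exact abs_le.2 ⟨by linarith, by linarith⟩
  · have : dist o ((k⁻¹ * h) • o) = dist (k • o) (h • o) := by
      rw [← hiso k o, smul_smul, mul_inv_cancel_left]
    rw [this]
    exact abs_le.2 ⟨by linarith, by linarith⟩

theorem annulus_nonempty {o : X} (hproper : ProperAction G X) (hgeo : GeodesicSpace X)
    {H : Subgroup G} (hHinf : (H : Set G).Infinite) {σ D : ℝ} (hD : σ ≤ D)
    (hqc : ∀ h h' : G, h ∈ H → h' ∈ H →
      ∀ γ : ℝ → X, γ 0 = h • o → γ (dist (h • o) (h' • o)) = h' • o →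
        IsGeodesicOn γ (dist (h • o) (h' • o)) →
        ∀ s ∈ Set.Icc 0 (dist (h • o) (h' • o)), ∃ h'' ∈ H, dist (γ s) (h'' • o) ≤ σ)
    {n : ℝ} (hn : 0 ≤ n) : (annulus o H n D).Nonempty := by
  obtain ⟨h, hh, hlt⟩ := hHinf.exists_notMem_finite (hproper.finite_orbitBall o n)
  simp only [mem_ofPred_eq, not_le] at hlt
  obtain ⟨k, hk, hk1, -⟩ := exists_mem_dist_near_of_quasiConvex hgeo hqc hh ⟨hn, hlt.le⟩
  exact ⟨k, hk, hk1.trans hD⟩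

theorem inter_orbitBall_subset_iUnion_annulus (o : X) (H : Subgroup G) {D : ℝ} (hD : 1 ≤ D)
    (N : ℕ) :
    (H : Set G) ∩ {g : G | dist o (g • o) ≤ (N : ℝ)} ⊆
      ⋃ k ∈ Finset.range (N + 1), annulus o H (k : ℝ) D := by
  rintro g ⟨hg, hd⟩
  have hd0 : 0 ≤ dist o (g • o) := dist_nonneg
  simp only [mem_iUnion]
  refine ⟨⌊dist o (g • o)⌋₊, ?_, hg, abs_le.2 ⟨?_, ?_⟩⟩
  · rw [Finset.mem_range, Nat.lt_succ_iff]
    exact Nat.floor_le_of_le hd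
  · linarith [Nat.floor_le hd0]
  · linarith [Nat.lt_floor_add_one (dist o (g • o))]

end AnnulusGrowth

/-- A subadditive nonnegative sequence is dominated by each of its linear slopes, up to a
constant. -/
theorem exists_forall_le_div_mul_add_of_subadditive {u : ℕ → ℝ} (hu : ∀ n, 0 ≤ u n)
    (hsub : ∀ n m, u (n + m) ≤ u n + u m) {n : ℕ} (hn : 0 < n) :
    ∃ C : ℝ, ∀ k, u k ≤ u n / n * k + C := by
  refine ⟨∑ r ∈ Finset.range n, u r, fun k => ?_⟩
  have hl : 0 ≤ u n / n := div_nonneg (hu n) n.cast_nonneg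
  induction k using Nat.strong_induction_on with
  | _ k ih =>
    rcases lt_or_ge k n with hk | hk
    · have := Finset.single_le_sum (f := u) (fun r _ => hu r) (Finset.mem_range.2 hk)
      have := mul_nonneg hl (Nat.cast_nonneg (α := ℝ) k)
      linarith
    · obtain ⟨j, rfl⟩ := Nat.exists_eq_add_of_le hk
      have h1 := hsub n j
      have h2 := ih j (by omega)
      have h3 : u n / n * n = u n := div_mul_cancel₀ _ (by positivity)
      push_cast
      linarith [mul_add (u n / n) (n : ℝ) j]

theorem tendsto_log_succ_add_const_div (C : ℝ) :
    Tendsto (fun N : ℕ => (Real.log ((N : ℝ) + 1) + C) / N) atTop (nhds 0) := by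
  have h1 : Tendsto (fun N : ℕ => Real.log ((N : ℝ) + 1) / ((N : ℝ) + 1)) atTop (nhds 0) :=
    (Real.isLittleO_log_id_atTop.tendsto_div_nhds_zero).comp
      (tendsto_atTop_add_const_right _ 1 tendsto_natCast_atTop_atTop)
  have h2 : Tendsto (fun N : ℕ => 1 + 1 / (N : ℝ)) atTop (nhds (1 + 0)) :=
    tendsto_const_nhds.add tendsto_one_div_atTop_nhds_zero_nat
  have h3 := (h1.mul h2).add (tendsto_const_div_atTop_nhds_zero_nat C)
  rw [zero_mul, zero_add] at h3
  refine h3.congr' ?_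
  filter_upwards [eventually_gt_atTop 0] with N hN
  have : (0 : ℝ) < N := by exact_mod_cast hN
  field_simp

/-- For an infinite quasi-convex subgroup `H`, there is `Δ ≥ 0` such that
`#𝒜(n, Δ) ≥ exp (ω(H) · n)` for every natural number `n`. -/
theorem annulus_lower_bound
    {X G : Type*} [MetricSpace X] [ProperSpace X] [Group G] [MulAction G X] (o : X)
    (hiso : IsometricAction G X) (hproper : ProperAction G X)
    (hgeo : GeodesicSpace X)
    (H : Subgroup G) (hHinf : (H : Set G).Infinite) (hqc : IsQuasiConvexSubgroup o H) :
    ∃ Δ : ℝ, 0 ≤ Δ ∧ ∀ n : ℕ,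
      Real.exp (growthRate o (H : Set G) * (n : ℝ)) ≤
        ((annulus o H (n : ℝ) Δ).ncard : ℝ) := by
  obtain ⟨σ, hσ, hqc⟩ := hqc
  refine ⟨2 * σ + 1, by positivity, fun n => ?_⟩
  set D := 2 * σ + 1 with hD
  set a : ℕ → ℕ := fun k => (annulus o H (k : ℝ) D).ncard with ha
  have hfin : ∀ k : ℕ, (annulus o H (k : ℝ) D).Finite := fun k => hproper.finite_annulus o H k D
  have ha1 : ∀ k, 1 ≤ a k := fun k =>
    (Set.ncard_pos (hfin k)).2
      (annulus_nonempty hproper hgeo hHinf (by linarith) hqc k.cast_nonneg)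
  have hamul : ∀ k m, a (k + m) ≤ a k * a m := fun k m => by
    have hsub := annulus_add_subset_mul (o := o) (D := D) hiso hgeo (by linarith) hqc
      (Nat.cast_nonneg (α := ℝ) k) (Nat.cast_nonneg (α := ℝ) m)
    rw [← Nat.cast_add] at hsub
    exact (Set.ncard_le_ncard hsub ((hfin k).mul (hfin m))).trans Set.natCard_mul_le
  have hapos : ∀ k, (0 : ℝ) < a k := fun k => by exact_mod_cast ha1 k
  rcases Nat.eq_zero_or_pos n with rfl | hn
  · simpa [ha] using ha1 0
  obtain ⟨C, hC⟩ := exists_forall_le_div_mul_add_of_subadditive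
    (u := fun k => Real.log (a k)) (fun k => Real.log_natCast_nonneg _)
    (fun k m => by
      rw [← Real.log_mul (hapos k).ne' (hapos m).ne']
      exact Real.log_le_log (hapos _) (by exact_mod_cast hamul k m)) hn
  set l := Real.log (a n) / n with hl
  have hl0 : 0 ≤ l := div_nonneg (Real.log_natCast_nonneg _) n.cast_nonneg
  have hball : ∀ N : ℕ,
      Real.log ((((H : Set G) ∩ {g : G | dist o (g • o) ≤ (N : ℝ)}).ncard : ℕ) : ℝ) ≤
        Real.log ((N : ℝ) + 1) + (l * N + C) := fun N => by
    have hpos : 0 < ((H : Set G) ∩ {g : G | dist o (g • o) ≤ (N : ℝ)}).ncard :=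
      (Set.ncard_pos ((hproper.finite_orbitBall o N).inter_of_right _)).2
        ⟨1, H.one_mem, by simp⟩
    have hcard : ((H : Set G) ∩ {g : G | dist o (g • o) ≤ (N : ℝ)}).ncard ≤
        ∑ k ∈ Finset.range (N + 1), a k :=
      (Set.ncard_le_ncard
        (inter_orbitBall_subset_iUnion_annulus o H (by linarith : 1 ≤ D) N)
        ((Finset.range (N + 1)).finite_toSet.biUnion fun k _ => hfin k)).trans
        (Finset.set_ncard_biUnion_le _ _)
    have hsum : ∑ k ∈ Finset.range (N + 1), (a k : ℝ) ≤
        ((N : ℝ) + 1) * Real.exp (l * N + C) := by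
      refine (Finset.sum_le_card_nsmul _ _ (Real.exp (l * N + C)) fun k hk => ?_).trans_eq
        (by simp)
      rw [← Real.log_le_iff_le_exp (hapos k)]
      have hkN : (k : ℝ) ≤ N := by
        exact_mod_cast Nat.lt_succ_iff.1 (Finset.mem_range.1 hk)
      linarith [hC k, mul_le_mul_of_nonneg_left hkN hl0]
    have hle := (Nat.cast_le (α := ℝ).2 hcard).trans ((Nat.cast_sum _ _).trans_le hsum)
    have := Real.log_le_log (by exact_mod_cast hpos) hle
    rwa [Real.log_mul (by positivity) (Real.exp_pos _).ne', Real.log_exp] at this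
  have hlim : Tendsto (fun N : ℕ => (Real.log ((N : ℝ) + 1) + C) / N + l) atTop (nhds l) := by
    simpa using (tendsto_log_succ_add_const_div C).add_const l
  have hω : growthRate o (H : Set G) ≤ l := by
    rw [growthRate, ← hlim.limsup_eq]
    refine limsup_le_limsup ?_ ?_ hlim.isBoundedUnder_le
    · filter_upwards [eventually_gt_atTop 0] with N hN
      have hN' : (0 : ℝ) < N := by exact_mod_cast hN
      rw [div_add' _ _ _ hN'.ne']
      gcongr
      linarith [hball N]
    · exact (isBoundedUnder_of ⟨0, fun N => div_nonneg (Real.log_natCast_nonneg _)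
        N.cast_nonneg⟩ : IsBoundedUnder (· ≥ ·) atTop _).isCoboundedUnder_le
  rw [← Real.le_log_iff_exp_le (hapos n)]
  calc growthRate o (H : Set G) * n ≤ l * n := by gcongr
    _ = Real.log (a n) := div_mul_cancel₀ _ (by positivity)
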